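/- arXiv:1111.1379 — 2 statements merged into one kernel-verified Lean document; each statement's English description precedes it below -/
import Mathlib

section
/- Let f be holomorphic in {z : R < |z| < ∞} with an essential singularity at z = ∞. Then limsup_{|z| → ∞} |z| f^#(z) = +∞. -/
/-- The spherical derivative of a holomorphic function. -/
noncomputable def sphericalDeriv (f : ℂ → ℂ) (z : ℂ) : ℝ :=
  ‖deriv f z‖ / (1 + ‖f z‖ ^ 2)

open Metric Filter Topology Complex

lemma aux_lip (F : ℂ → ℂ) (hF : DifferentiableOn ℂ F (ball 0 1))
    (hs : ∀ z ∈ ball (0:ℂ) 1, ‖deriv F z‖ ≤ (1/8) * (1 + ‖F z‖^2))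
    (a b : ℂ) (ha : a ∈ ball (0:ℂ) 1) (hb : b ∈ ball (0:ℂ) 1) (h1 : ‖F a‖ < 1) : ‖F b‖ ≤ 2 := by
  by_contra! h2
  have hd : ∀ z ∈ ball (0:ℂ) 1, ∃ L : ℂ →L[ℝ] ℝ,
      HasFDerivWithinAt (fun z => (1 + ‖F z‖^2)⁻¹) L (ball (0:ℂ) 1) z ∧ ‖L‖ ≤ 1/8 := by
    intro z hz
    have hFz : HasFDerivAt F ((fderiv ℂ F z).restrictScalars ℝ) z :=
      ((hF.differentiableAt (isOpen_ball.mem_nhds hz)).hasFDerivAt).restrictScalars ℝ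
    have h3 := (hFz.norm_sq).const_add 1
    have hpos : 0 < 1 + ‖F z‖^2 := by positivity
    have h4 := (hasDerivAt_inv hpos.ne').comp_hasFDerivAt z h3
    refine ⟨_, h4.hasFDerivWithinAt, ?_⟩
    refine ContinuousLinearMap.opNorm_le_bound _ (by norm_num) fun v => ?_
    have h5 : ‖fderiv ℂ F z v‖ ≤ (1/8) * (1 + ‖F z‖^2) * ‖v‖ := by
      refine ((fderiv ℂ F z).le_opNorm v).trans ?_
      rw [← norm_deriv_eq_norm_fderiv]
      gcongr
      exact hs z hz
    have h6 : |inner ℝ (F z) (fderiv ℂ F z v)| ≤ ‖F z‖ * ((1/8) * (1 + ‖F z‖^2) * ‖v‖) :=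
      (abs_real_inner_le_norm _ _).trans (by gcongr)
    simp only [smul_apply, ContinuousLinearMap.comp_apply, smul_eq_mul,
      norm_mul, Real.norm_eq_abs, abs_neg, innerSL_apply_apply,
      ContinuousLinearMap.coe_restrictScalars', nsmul_eq_mul, Nat.cast_ofNat, abs_two]
    rw [abs_inv, abs_of_pos (by positivity : 0 < (1 + ‖F z‖^2)^2), inv_mul_le_iff₀ (by positivity)]
    have hv := norm_nonneg v
    have h7 : 2 * ‖F z‖ ≤ 1 + ‖F z‖^2 := by nlinarith [sq_nonneg (‖F z‖ - 1)]
    calc 2 * |inner ℝ (F z) (fderiv ℂ F z v)| ≤ 2 * (‖F z‖ * ((1/8) * (1 + ‖F z‖^2) * ‖v‖)) := by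
          gcongr
      _ = (2 * ‖F z‖) * ((1/8) * (1 + ‖F z‖^2) * ‖v‖) := by ring
      _ ≤ (1 + ‖F z‖^2) * ((1/8) * (1 + ‖F z‖^2) * ‖v‖) := by gcongr
      _ = _ := by ring
  choose! L hL hL2 using hd
  have := (convex_ball (0:ℂ) 1).norm_image_sub_le_of_norm_hasFDerivWithin_le hL hL2 hb ha
  have hab : ‖a - b‖ ≤ 2 := by
    rw [mem_ball_zero_iff] at ha hb
    linarith [norm_sub_le a b]
  have h8 : (1/2:ℝ) ≤ (1 + ‖F a‖^2)⁻¹ := by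
    rw [one_div]; apply inv_anti₀ (by positivity); nlinarith [norm_nonneg (F a)]
  have h9 : (1 + ‖F b‖^2)⁻¹ ≤ (1/5:ℝ) := by
    rw [one_div]; apply inv_anti₀ (by positivity); nlinarith
  have h10 := (le_abs_self _).trans this
  linarith

noncomputable def auxPhi (K : ℝ) : ℝ := Real.exp (2 + 3 * (Real.log K + Real.pi))

lemma auxPhi_ge {K : ℝ} (hK : 1 ≤ K) : 2 ≤ auxPhi K := by
  unfold auxPhi
  have := Real.add_one_le_exp (2 + 3 * (Real.log K + Real.pi))
  have := Real.log_nonneg hK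
  have := Real.pi_pos
  linarith

lemma aux_bound (F : ℂ → ℂ) (hF : DifferentiableOn ℂ F (ball 0 1))
    (hs : ∀ z ∈ ball (0:ℂ) 1, ‖deriv F z‖ ≤ (1/8) * (1 + ‖F z‖^2))
    (K : ℝ) (hK : 1 ≤ K) (h0 : ‖F 0‖ ≤ K) (z : ℂ) (hz : ‖z‖ ≤ 1/2) : ‖F z‖ ≤ auxPhi K := by
  have hzb : z ∈ ball (0:ℂ) 1 := by rw [mem_ball_zero_iff]; linarith
  have h0b : (0:ℂ) ∈ ball (0:ℂ) 1 := by simp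
  by_cases hc : ∃ a ∈ ball (0:ℂ) 1, ‖F a‖ < 1
  · obtain ⟨a, ha, ha1⟩ := hc
    exact (aux_lip F hF hs a z ha hzb ha1).trans (auxPhi_ge hK)
  push Not at hc
  have hne : ∀ w ∈ ball (0:ℂ) 1, F w ≠ 0 := fun w hw h => by
    have := hc w hw; rw [h, norm_zero] at this; linarith
  have hdiv : DifferentiableOn ℂ (fun w => deriv F w / F w) (ball 0 1) :=
    (hF.deriv isOpen_ball).div hF hne
  obtain ⟨φ, hφ0, hφ⟩ := hdiv.isExactOn_ball.with_val_at 0 (Complex.log (F 0))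
  have hG : ∀ w ∈ ball (0:ℂ) 1, HasDerivWithinAt (fun w => exp (-φ w) * F w) 0 (ball 0 1) w := by
    intro w hw
    have h1 := ((hφ w hw).neg.cexp).mul
      ((hF.differentiableAt (isOpen_ball.mem_nhds hw)).hasDerivAt)
    refine (h1.congr_deriv ?_).hasDerivWithinAt
    have := hne w hw
    field_simp
    simp
  have hconst : ∀ w ∈ ball (0:ℂ) 1, F w = exp (φ w) := by
    intro w hw
    have h1 := (convex_ball (0:ℂ) 1).norm_image_sub_le_of_norm_hasDerivWithin_le (C := 0)
      hG (by simp) h0b hw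
    simp only [zero_mul, norm_le_zero_iff, sub_eq_zero] at h1
    rw [hφ0, Complex.exp_neg (Complex.log _), Complex.exp_log (hne 0 h0b), inv_mul_cancel₀ (hne 0 h0b),
      Complex.exp_neg, inv_mul_eq_iff_eq_mul₀ (exp_ne_zero _), mul_one] at h1
    exact h1
  have hre : ∀ w ∈ ball (0:ℂ) 1, 0 ≤ (φ w).re := by
    intro w hw
    have := hc w hw
    rw [hconst w hw, Complex.norm_exp] at this
    exact Real.one_le_exp_iff.mp this
  have hbc := Complex.borelCaratheodory (f := fun w => -φ w) (M := 1) (R := 1) (z := z) one_pos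
    (fun w hw => (hφ w hw).differentiableAt.neg.differentiableWithinAt)
    (fun w hw => by have := hre w hw; simp; linarith) one_pos hzb
  simp only [norm_neg, hφ0] at hbc
  have hlog : ‖Complex.log (F 0)‖ ≤ Real.log K + Real.pi := by
    refine (Complex.norm_le_abs_re_add_abs_im _).trans ?_
    have h1 := hc 0 h0b
    rw [Complex.log_re, Complex.log_im, abs_of_nonneg (Real.log_nonneg h1)]
    have := Real.log_le_log (by linarith) h0
    have := Complex.abs_arg_le_pi (F 0)
    linarith
  have hn := norm_nonneg z
  have hp : 0 < 1 - ‖z‖ := by linarith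
  have e1 : 2 * 1 * ‖z‖ / (1 - ‖z‖) ≤ 2 := by rw [div_le_iff₀ hp]; linarith
  have e2 : ‖Complex.log (F 0)‖ * (1 + ‖z‖) / (1 - ‖z‖) ≤ 3 * ‖Complex.log (F 0)‖ := by
    rw [div_le_iff₀ hp]; nlinarith [norm_nonneg (Complex.log (F 0))]
  rw [hconst z hzb, Complex.norm_exp, auxPhi]
  apply Real.exp_le_exp.mpr
  linarith [Complex.re_le_norm (φ z)]

lemma aux_step (f : ℂ → ℂ) (R M : ℝ) (hR : 0 < R) (hM : 0 < M)
    (hf : DifferentiableOn ℂ f {z : ℂ | R < ‖z‖})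
    (hb : ∀ z : ℂ, R < ‖z‖ → ‖z‖ * sphericalDeriv f z ≤ M)
    (K : ℝ) (hK : 1 ≤ K) (z₀ w : ℂ) (hz : 2 * R < ‖z₀‖) (h0 : ‖f z₀‖ ≤ K)
    (hw : ‖w - z₀‖ ≤ 1 / (16 * M + 2) * ‖z₀‖ / 2) : ‖f w‖ ≤ auxPhi K := by
  set δ := 1 / (16 * M + 2) with hδ
  have hδ0 : 0 < δ := by positivity
  have hδ1 : δ * (16 * M + 2) = 1 := by rw [hδ]; field_simp
  have hδ2 : δ ≤ 1/2 := by nlinarith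
  have hz0 : 0 < ‖z₀‖ := by linarith
  set c : ℂ := ((δ * ‖z₀‖ : ℝ) : ℂ) with hcdef
  have hc : ‖c‖ = δ * ‖z₀‖ := by
    rw [hcdef, Complex.norm_real, Real.norm_of_nonneg (by positivity)]
  have hc0 : c ≠ 0 := by rw [← norm_pos_iff, hc]; positivity
  have hopen : IsOpen {z : ℂ | R < ‖z‖} := isOpen_lt continuous_const continuous_norm
  have hlow : ∀ ζ ∈ ball (0:ℂ) 1, ‖z₀‖ / 2 ≤ ‖z₀ + c * ζ‖ := by
    intro ζ hζ
    rw [mem_ball_zero_iff] at hζ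
    have h1 : ‖z₀‖ - ‖c * ζ‖ ≤ ‖z₀ + c * ζ‖ := by
      have := norm_sub_le (z₀ + c * ζ) (c * ζ); rw [add_sub_cancel_right] at this; linarith
    rw [norm_mul, hc] at h1
    have : δ * ‖z₀‖ * ‖ζ‖ ≤ 1/2 * ‖z₀‖ * 1 := by gcongr
    linarith
  have hder : ∀ ζ ∈ ball (0:ℂ) 1,
      HasDerivAt (fun ζ => f (z₀ + c * ζ)) (deriv f (z₀ + c * ζ) * c) ζ := by
    intro ζ hζ
    have hmem : R < ‖z₀ + c * ζ‖ := by linarith [hlow ζ hζ]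
    have h1 := (hf.differentiableAt (hopen.mem_nhds hmem)).hasDerivAt
    have h2 : HasDerivAt (fun ζ : ℂ => z₀ + c * ζ) c ζ := by
      simpa using ((hasDerivAt_id ζ).const_mul c).const_add z₀
    exact h1.comp ζ h2
  have key := aux_bound (fun ζ => f (z₀ + c * ζ))
    (fun ζ hζ => (hder ζ hζ).differentiableAt.differentiableWithinAt) ?_ K hK (by simpa using h0)
    ((w - z₀) / c) ?_
  · simpa [mul_div_cancel₀ _ hc0, mul_div_cancel_left₀] using key
  · intro ζ hζ
    rw [(hder ζ hζ).deriv, norm_mul, hc]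
    have hl := hlow ζ hζ
    have h1 := hb (z₀ + c * ζ) (by linarith)
    unfold sphericalDeriv at h1
    set D := ‖deriv f (z₀ + c * ζ)‖ with hD
    have hD0 : 0 ≤ D := norm_nonneg _
    set P := 1 + ‖f (z₀ + c * ζ)‖^2 with hP
    have hP0 : 0 < P := by positivity
    rw [← mul_div_assoc, div_le_iff₀ hP0] at h1
    have h2 : ‖z₀‖ / 2 * D ≤ M * P := le_trans (by gcongr) h1
    calc D * (δ * ‖z₀‖) = 2 * δ * (‖z₀‖ / 2 * D) := by ring
      _ ≤ 2 * δ * (M * P) := by gcongr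
      _ = (2 * δ * M) * P := by ring
      _ ≤ 1/8 * P := by gcongr; nlinarith
  · rw [norm_div, hc, div_le_iff₀ (by positivity)]
    linarith

noncomputable def auxIter (K : ℝ) : ℕ → ℝ
  | 0 => K
  | n+1 => auxPhi (auxIter K n)

lemma auxIter_ge {K : ℝ} (hK : 1 ≤ K) (n : ℕ) : 1 ≤ auxIter K n := by
  induction n with
  | zero => exact hK
  | succ n ih => have := auxPhi_ge ih; rw [auxIter]; linarith

lemma aux_circle (f : ℂ → ℂ) (R M : ℝ) (hR : 0 < R) (hM : 0 < M)
    (hf : DifferentiableOn ℂ f {z : ℂ | R < ‖z‖})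
    (hb : ∀ z : ℂ, R < ‖z‖ → ‖z‖ * sphericalDeriv f z ≤ M)
    (K : ℝ) (hK : 1 ≤ K) : ∃ K' : ℝ, ∀ z₀ : ℂ, 2 * R < ‖z₀‖ → ‖f z₀‖ ≤ K →
      ∀ w : ℂ, ‖w‖ = ‖z₀‖ → ‖f w‖ ≤ K' := by
  set δ := 1 / (16 * M + 2) with hδ
  have hδ0 : 0 < δ := by positivity
  obtain ⟨N, hN⟩ := exists_nat_gt (Real.pi / (δ / 2))
  have hN0 : (0:ℝ) < N := lt_of_le_of_lt (by positivity) hN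
  refine ⟨auxIter K N, fun z₀ hz₀ h0 w hw => ?_⟩
  have hz0 : 0 < ‖z₀‖ := by linarith
  have hz0' : z₀ ≠ 0 := norm_pos_iff.mp hz0
  set θ := Complex.arg (w / z₀) with hθ
  have hwz : w = z₀ * exp (θ * I) := by
    have h1 := Complex.norm_mul_exp_arg_mul_I (w / z₀)
    rw [norm_div, hw, div_self hz0.ne', ofReal_one, one_mul] at h1
    rw [hθ, h1]; field_simp
  have hθN : |θ / N| ≤ δ / 2 := by
    rw [abs_div, abs_of_pos hN0, div_le_iff₀ hN0]
    rw [div_lt_iff₀ (by positivity)] at hN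
    linarith [Complex.abs_arg_le_pi (w / z₀)]
  have main : ∀ n : ℕ, ‖f (z₀ * exp ((n * (θ / N) : ℝ) * I))‖ ≤ auxIter K n := by
    intro n
    induction n with
    | zero => simpa [auxIter] using h0
    | succ n ih =>
      have hn1 : ‖z₀ * exp ((n * (θ / N) : ℝ) * I)‖ = ‖z₀‖ := by
        rw [norm_mul, Complex.norm_exp_ofReal_mul_I, mul_one]
      refine aux_step f R M hR hM hf hb _ (auxIter_ge hK n) _ _ (by rw [hn1]; exact hz₀) ih ?_
      rw [hn1, ← hδ]
      have : z₀ * exp (((n+1:ℕ) * (θ / N) : ℝ) * I) - z₀ * exp ((n * (θ / N) : ℝ) * I)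
          = z₀ * exp ((n * (θ / N) : ℝ) * I) * (exp (I * (θ / N : ℝ)) - 1) := by
        rw [mul_sub, mul_assoc, ← Complex.exp_add]
        push_cast
        ring_nf
      rw [this, norm_mul, hn1]
      have h2 := Real.norm_exp_I_mul_ofReal_sub_one_le (x := θ / N)
      rw [Real.norm_eq_abs] at h2
      calc ‖z₀‖ * _ ≤ ‖z₀‖ * (δ / 2) := by gcongr; exact h2.trans hθN
        _ = _ := by ring
  have := main N
  rwa [mul_div_cancel₀ _ hN0.ne', ← hwz] at this

lemma aux_mero (g : ℂ → ℂ) (hd : ∀ᶠ z in 𝓝[≠] (0:ℂ), DifferentiableAt ℂ g z) (C : ℝ)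
    (hb : ∀ᶠ z in 𝓝[≠] (0:ℂ), ‖g z‖ ≤ C) : MeromorphicAt g 0 := by
  have h1 : AnalyticAt ℂ (fun z => z * (z * g z)) 0 := by
    apply Complex.analyticAt_of_differentiable_on_punctured_nhds_of_continuousAt
    · filter_upwards [hd] with z hz
      fun_prop
    · rw [continuousAt_iff_punctured_nhds]
      simp only [zero_mul]
      have hid : Tendsto (fun z : ℂ => ‖z‖ * (‖z‖ * C)) (𝓝[≠] 0) (𝓝 0) := by
        have : Continuous (fun z : ℂ => ‖z‖ * (‖z‖ * C)) := by fun_prop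
        simpa using (this.tendsto 0).mono_left nhdsWithin_le_nhds
      refine squeeze_zero_norm' ?_ hid
      filter_upwards [hb] with z hz
      rw [norm_mul, norm_mul]
      gcongr
  refine ⟨2, ?_⟩
  have h2 : (fun z : ℂ => (z - 0) ^ 2 • g z) = fun z => z * (z * g z) := by
    funext z
    simp [pow_two, mul_assoc]
  rw [h2]
  exact h1

theorem stmt_18 (R : ℝ) (f : ℂ → ℂ)
    (hf : DifferentiableOn ℂ f {z : ℂ | R < ‖z‖})
    (hess : ¬ MeromorphicAt (fun w : ℂ => f w⁻¹) 0) :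
    ∀ M : ℝ, ∃ᶠ z : ℂ in Filter.comap (fun z : ℂ => ‖z‖) Filter.atTop,
      M ≤ ‖z‖ * sphericalDeriv f z := by
  intro M₀ hcon
  apply hess
  rw [Filter.eventually_comap] at hcon
  obtain ⟨R₀, hR₀⟩ := Filter.eventually_atTop.mp hcon
  set S := max (max R₀ R) 1 with hS
  have hS0 : 0 < S := lt_of_lt_of_le one_pos (le_max_right _ _)
  have hSR : R ≤ S := (le_max_right _ _).trans (le_max_left _ _)
  have hSR₀ : R₀ ≤ S := (le_max_left _ _).trans (le_max_left _ _)
  set M := max M₀ 1 with hMdef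
  have hM : 0 < M := lt_of_lt_of_le one_pos (le_max_right _ _)
  have hfS : DifferentiableOn ℂ f {z : ℂ | S < ‖z‖} :=
    hf.mono fun z (hz : S < ‖z‖) => lt_of_le_of_lt hSR hz
  have hb : ∀ z : ℂ, S < ‖z‖ → ‖z‖ * sphericalDeriv f z ≤ M := fun z hz =>
    (not_le.mp (hR₀ ‖z‖ (by linarith) z rfl)).le.trans (le_max_left _ _)
  have hopen : IsOpen {z : ℂ | S < ‖z‖} := isOpen_lt continuous_const continuous_norm
  have hnear : ∀ T : ℝ, ∀ᶠ z in 𝓝[≠] (0:ℂ), T < ‖z⁻¹‖ := fun T =>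
    (tendsto_norm_cobounded_atTop.comp (tendsto_inv₀_nhdsNE_zero (α := ℂ))).eventually_gt_atTop T
  have hdz : ∀ᶠ z in 𝓝[≠] (0:ℂ), DifferentiableAt ℂ (fun w => f w⁻¹) z := by
    filter_upwards [hnear S, self_mem_nhdsWithin] with z hz hz0
    exact (hfS.differentiableAt (hopen.mem_nhds hz)).comp z (differentiableAt_inv hz0)
  by_cases hc : ∃ T : ℝ, ∀ z : ℂ, T < ‖z‖ → 1 < ‖f z‖
  · obtain ⟨T, hT⟩ := hc
    have := aux_mero (fun w => (f w⁻¹)⁻¹) ?_ 1 ?_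
    · simpa using this.fun_inv
    · filter_upwards [hdz, hnear T] with z hz hz1
      have := hT _ hz1
      exact hz.inv (norm_pos_iff.mp (by linarith))
    · filter_upwards [hnear T] with z hz1
      have := hT _ hz1
      rw [norm_inv]
      exact inv_le_one_of_one_le₀ this.le
  · push Not at hc
    obtain ⟨K', hK'⟩ := aux_circle f S M hS0 hM hfS hb 1 le_rfl
    obtain ⟨z₁, hz₁, hz₁f⟩ := hc (2 * S)
    refine aux_mero _ hdz K' ?_
    filter_upwards [hnear ‖z₁‖] with z hz
    obtain ⟨z₂, hz₂, hz₂f⟩ := hc ‖z⁻¹‖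
    set U : Set ℂ := {w | ‖z₁‖ < ‖w‖ ∧ ‖w‖ < ‖z₂‖} with hU
    have hUo : IsOpen U := (isOpen_lt continuous_const continuous_norm).inter
      (isOpen_lt continuous_norm continuous_const)
    have hUb : Bornology.IsBounded U :=
      (isBounded_ball (x := (0:ℂ)) (r := ‖z₂‖)).subset fun w hw => by simpa using hw.2
    have hcl : closure U ⊆ {w | ‖z₁‖ ≤ ‖w‖ ∧ ‖w‖ ≤ ‖z₂‖} :=
      closure_minimal (fun w hw => ⟨hw.1.le, hw.2.le⟩)
        ((isClosed_le continuous_const continuous_norm).inter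
          (isClosed_le continuous_norm continuous_const))
    refine Complex.norm_le_of_forall_mem_frontier_norm_le hUb (f := f) (C := K') ?_ ?_
      (subset_closure ⟨hz, hz₂⟩)
    · apply DifferentiableOn.diffContOnCl
      exact hfS.mono fun w hw => by
        have := (hcl hw).1
        show S < ‖w‖
        linarith
    · intro w hw
      rw [hUo.frontier_eq] at hw
      obtain ⟨hw1, hw2⟩ := hw
      have h3 := hcl hw1
      rcases h3.1.eq_or_lt with h | h
      · exact hK' z₁ hz₁ hz₁f w h.symm
      · rcases h3.2.eq_or_lt with h' | h'
        · exact hK' z₂ (by linarith) hz₂f w h'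
        · exact absurd ⟨h, h'⟩ hw2
end

section
/- Let G be an entire function, and suppose there exists M > 0 such that for every n ≥ 1 and every z with 1 ≤ |z| ≤ 2, the function t_n(z) = G(2^n z)/2^{n m} (for a fixed positive integer m) satisfies t_n^#(z) ≤ M. Then r(ζ) := G(ζ)/ζ^m satisfies |ζ| r^#(ζ) ≤ M·2^{m+1} + m·2^{2m} for all |ζ| ≥ 2; consequently G cannot be transcendental. -/
open Complex Metric Filter Topology

lemma aux_log_branch {f : ℂ → ℂ} {c : ℂ} {r : ℝ} (hr : 0 < r)
    (hf : DifferentiableOn ℂ f (ball c r)) (h0 : ∀ z ∈ ball c r, f z ≠ 0) :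
    ∃ g : ℂ → ℂ, (∀ z ∈ ball c r, HasDerivAt g (deriv f z / f z) z) ∧
      ∀ z ∈ ball c r, exp (g z) = f z := by
  have hd : DifferentiableOn ℂ (fun z => deriv f z / f z) (ball c r) :=
    (hf.deriv isOpen_ball).div hf h0
  obtain ⟨g, hg0, hg⟩ := hd.isExactOn_ball.with_val_at c (log (f c))
  have hc : c ∈ ball c r := mem_ball_self hr
  refine ⟨g, hg, fun z hz => ?_⟩
  have key : ∀ x ∈ ball c r, HasDerivWithinAt (fun z => f z * exp (-g z)) 0 (ball c r) x := by
    intro x hx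
    have h1 := (hf.differentiableAt (isOpen_ball.mem_nhds hx)).hasDerivAt
    have h2 := h1.mul ((hg x hx).neg.cexp)
    refine (h2.congr_deriv ?_).hasDerivWithinAt
    have := h0 x hx
    simp only [Pi.neg_apply]
    field_simp
    ring
  have := (convex_ball c r).norm_image_sub_le_of_norm_hasDerivWithin_le (C := 0) key
    (by simp) hc hz
  simp only [zero_mul, norm_le_zero_iff, sub_eq_zero, hg0, exp_neg, exp_log (h0 c hc),
    mul_inv_cancel₀ (h0 c hc)] at this
  have h3 := exp_ne_zero (g z)
  field_simp at this
  exact this.symm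

/-- Harnack type gradient estimate. -/
lemma aux_harnack {f : ℂ → ℂ} {c : ℂ} {r : ℝ} (hr : 0 < r)
    (hf : DifferentiableOn ℂ f (ball c r)) (h0 : ∀ z ∈ ball c r, 1 / 4 < ‖f z‖) :
    ‖deriv f c‖ ≤ ‖f c‖ * (2 / r * (Real.log ‖f c‖ + Real.log 4)) := by
  have hne : ∀ z ∈ ball c r, f z ≠ 0 := fun z hz h => by
    have := h0 z hz
    rw [h, norm_zero] at this
    norm_num at this
  obtain ⟨g, hg, hexp⟩ := aux_log_branch hr hf hne
  have hc : c ∈ ball c r := mem_ball_self hr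
  have hre : ∀ z ∈ ball c r, (g z).re = Real.log ‖f z‖ := by
    intro z hz
    rw [← hexp z hz, norm_exp, Real.log_exp]
  have hpos : ∀ z ∈ ball c r, 0 < (g z).re + Real.log 4 := by
    intro z hz
    rw [hre z hz, ← Real.log_mul (norm_ne_zero_iff.2 (hne z hz)) (by norm_num)]
    apply Real.log_pos
    linarith [h0 z hz]
  set a : ℝ := (g c).re + Real.log 4 with ha
  have hapos : 0 < a := hpos c hc
  -- the Mobius transform
  set q : ℂ → ℂ := fun z => (g z - g c) / (g z - g c + (2 * a : ℝ)) with hq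
  have hden : ∀ z ∈ ball c r, 0 < (g z - g c + (2 * a : ℝ)).re := by
    intro z hz
    have := hpos z hz
    simp only [add_re, sub_re, ofReal_re]
    linarith
  have hden' : ∀ z ∈ ball c r, g z - g c + (2 * a : ℝ) ≠ 0 := fun z hz h => by
    have := hden z hz
    rw [h] at this
    simp at this
  have hgd : DifferentiableOn ℂ g (ball c r) := fun z hz =>
    (hg z hz).differentiableAt.differentiableWithinAt
  have hqd : DifferentiableOn ℂ q (ball c r) :=
    (hgd.sub_const _).div ((hgd.sub_const _).add_const _) hden'
  have hqm : Set.MapsTo q (ball c r) (ball (q c) 1) := by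
    intro z hz
    have hqc : q c = 0 := by simp [hq]
    rw [hqc, mem_ball_zero_iff, hq]
    simp only [norm_div]
    rw [div_lt_one (norm_pos_iff.2 (hden' z hz))]
    apply lt_of_pow_lt_pow_left₀ 2 (norm_nonneg _)
    rw [← normSq_eq_norm_sq, ← normSq_eq_norm_sq, normSq_apply, normSq_apply]
    have := hpos z hz
    simp only [add_re, sub_re, ofReal_re, add_im, ofReal_im, sub_im]
    nlinarith
  have h1 := norm_deriv_le_div_of_mapsTo_ball hqd (hqm.mono_right ball_subset_closedBall) hr
  have h2 : HasDerivAt q ((deriv f c / f c) / (2 * a : ℝ)) c := by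
    have h3 := ((hg c hc).sub_const (g c))
    have h4 := h3.div (h3.add_const ((2 * a : ℝ) : ℂ)) (by simpa using hden' c hc)
    refine h4.congr_deriv ?_
    have : ((2 * a : ℝ) : ℂ) ≠ 0 := by exact_mod_cast (by positivity : (2 * a : ℝ) ≠ 0)
    simp only [sub_self, zero_add, zero_mul, sub_zero]
    generalize ((2 * a : ℝ) : ℂ) = A at *
    field_simp
  rw [h2.deriv, norm_div, norm_div, norm_real, Real.norm_of_nonneg (by positivity)] at h1
  have hfc : 0 < ‖f c‖ := norm_pos_iff.2 (hne c hc)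
  rw [← hre c hc, ← ha]
  rw [div_le_div_iff₀ (by positivity) hr] at h1
  rw [div_mul_eq_mul_div, div_le_iff₀ hfc] at h1
  rw [show ‖f c‖ * (2 / r * a) = (1 * (2 * a) * ‖f c‖) / r by ring, le_div_iff₀ hr]
  exact h1

/-- An entire function with polynomial growth along a sequence of circles is a polynomial. -/
lemma aux_poly {G : ℂ → ℂ} (hG : Differentiable ℂ G) (K : ℝ) (m : ℕ)
    (h : ∀ R₀ : ℝ, ∃ R : ℝ, R₀ ≤ R ∧ ∀ z : ℂ, ‖z‖ = R → ‖G z‖ ≤ K * R ^ m) :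
    ∃ p : Polynomial ℂ, ∀ z : ℂ, G z = p.eval z := by
  have hz : ∀ k : ℕ, m < k → iteratedDeriv k G 0 = 0 := by
    intro k hk
    rw [← norm_le_zero_iff]
    apply le_of_forall_pos_le_add
    intro ε hε
    obtain ⟨R, hR, hb⟩ := h (max 1 (k.factorial * |K| / ε))
    have hR1 : 1 ≤ R := (le_max_left _ _).trans hR
    have hR2 : k.factorial * |K| / ε ≤ R := (le_max_right _ _).trans hR
    have hR0 : 0 < R := by linarith
    have h1 := norm_iteratedDeriv_le_of_forall_mem_sphere_norm_le k hR0
      (hG.diffContOnCl (s := ball 0 R)) (C := K * R ^ m)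
      (fun z hz => hb z (by simpa using hz))
    refine h1.trans ?_
    rw [zero_add, div_le_iff₀ (by positivity)]
    rw [div_le_iff₀ hε] at hR2
    calc k.factorial * (K * R ^ m) ≤ k.factorial * (|K| * R ^ m) := by
          gcongr; exact le_abs_self K
      _ = (k.factorial * |K|) * R ^ m := by ring
      _ ≤ (R * ε) * R ^ m := by gcongr
      _ = ε * R ^ (m + 1) := by ring
      _ ≤ ε * R ^ k := by gcongr; exact hk
  refine ⟨∑ n ∈ Finset.range (m + 1),
    Polynomial.C ((n.factorial : ℂ)⁻¹ * iteratedDeriv n G 0) * Polynomial.X ^ n, fun z => ?_⟩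
  rw [← taylorSeries_eq_of_entire' 0 z hG, tsum_eq_sum (s := Finset.range (m + 1)),
    Polynomial.eval_finsetSum]
  · simp
  · intro n hn
    rw [hz n (by simpa using hn)]
    simp

/-- An entire function tending to infinity has polynomial growth. -/
lemma aux_proper {G : ℂ → ℂ} (hG : Differentiable ℂ G)
    (h : ∀ B : ℝ, ∃ R : ℝ, ∀ z : ℂ, R ≤ ‖z‖ → B ≤ ‖G z‖) :
    ∃ p : Polynomial ℂ, ∀ z : ℂ, G z = p.eval z := by
  set H : ℂ → ℂ := Function.update (fun z => (G z⁻¹)⁻¹) 0 0 with hH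
  have hHne : ∀ z : ℂ, z ≠ 0 → H z = (G z⁻¹)⁻¹ := fun z hz => by
    simp [hH, Function.update_of_ne hz]
  have hH0 : H 0 = 0 := by simp [hH]
  have hev : ∀ B : ℝ, ∀ᶠ z in 𝓝[≠] (0 : ℂ), B ≤ ‖G z⁻¹‖ := by
    intro B
    obtain ⟨R, hR⟩ := h B
    have := (tendsto_norm_inv_nhdsNE_zero_atTop (α := ℂ)).eventually_ge_atTop R
    filter_upwards [this] with z hz using hR _ hz
  have hne : ∀ᶠ z in 𝓝[≠] (0 : ℂ), H z ≠ 0 := by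
    filter_upwards [hev 1, self_mem_nhdsWithin] with z hz hz0
    rw [hHne z hz0]
    apply inv_ne_zero
    intro h0
    rw [h0, norm_zero] at hz
    linarith
  have hd : ∀ᶠ z in 𝓝[≠] (0 : ℂ), DifferentiableAt ℂ H z := by
    filter_upwards [hne, self_mem_nhdsWithin] with z hz hz0
    rw [hHne z hz0] at hz
    have h1 : DifferentiableAt ℂ (fun z => (G z⁻¹)⁻¹) z :=
      ((hG _).comp z (differentiableAt_inv hz0)).inv (fun h0 => hz (by simpa using h0))
    refine h1.congr_of_eventuallyEq ?_
    filter_upwards [isOpen_ne.mem_nhds hz0] with w hw using hHne w hw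
  have hc : ContinuousAt H 0 := by
    rw [hH, continuousAt_update_same, tendsto_zero_iff_norm_tendsto_zero]
    simp only [norm_inv]
    apply tendsto_inv_atTop_zero.comp
    exact tendsto_atTop.2 hev
  have han := analyticAt_of_differentiable_on_punctured_nhds_of_continuousAt hd hc
  have hnz : ¬ ∀ᶠ z in 𝓝 (0 : ℂ), H z = 0 := by
    intro h0
    have h1 := (h0.filter_mono nhdsWithin_le_nhds).and hne
    obtain ⟨z, hz1, hz2⟩ := h1.exists
    exact hz2 hz1
  obtain ⟨n, g, hg, hg0, hgeq⟩ := han.exists_eventuallyEq_pow_smul_nonzero_iff.2 hnz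
  have hgn : ∀ᶠ z in 𝓝 (0 : ℂ), ‖g 0‖ / 2 < ‖g z‖ :=
    hg.continuousAt.norm.eventually (lt_mem_nhds (half_lt_self (norm_pos_iff.2 hg0)))
  obtain ⟨ε, hε, hball⟩ := Metric.eventually_nhds_iff.1 (hgeq.and hgn)
  have hg0' : 0 < ‖g 0‖ := norm_pos_iff.2 hg0
  refine aux_poly hG (2 / ‖g 0‖) n fun R₀ => ⟨max R₀ (2 / ε), le_max_left _ _, fun z hz => ?_⟩
  have hR : 2 / ε ≤ ‖z‖ := hz ▸ le_max_right _ _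
  have hzpos : 0 < ‖z‖ := lt_of_lt_of_le (by positivity) hR
  have hz0 : z ≠ 0 := norm_pos_iff.1 hzpos
  have hlt : dist z⁻¹ 0 < ε := by
    rw [dist_zero_right, norm_inv, inv_lt_comm₀ hzpos hε]
    refine lt_of_lt_of_le ?_ hR
    rw [inv_eq_one_div]
    gcongr
    norm_num
  obtain ⟨h1, h2⟩ := hball hlt
  rw [hHne _ (inv_ne_zero hz0), inv_inv, sub_zero, smul_eq_mul] at h1
  have h3 : ‖G z‖ = ‖z‖ ^ n * ‖g z⁻¹‖⁻¹ := by
    rw [← inv_inv (G z), h1]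
    simp [mul_comm]
  rw [h3, ← hz, mul_comm]
  gcongr
  rw [← inv_div]
  gcongr

lemma aux_line {F : ℂ → ℂ} {w v : ℂ} {t : ℝ} (hF : DifferentiableAt ℂ F (w + t * v)) :
    HasDerivAt (fun s : ℝ => F (w + s * v)) (deriv F (w + t * v) * v) t := by
  have h1 : HasDerivAt (fun s : ℂ => w + s * v) v (t : ℂ) := by
    simpa using ((hasDerivAt_id (t : ℂ)).mul_const v).const_add w
  exact (HasDerivAt.comp (t : ℂ) hF.hasDerivAt h1).comp_ofReal

lemma aux_lower {F : ℂ → ℂ} {c : ℂ} {r C : ℝ} (hC : 0 < C)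
    (hrC : r ≤ 1 / (4 * C)) (hF : DifferentiableOn ℂ F (ball c r))
    (hb : ∀ z ∈ ball c r, ‖deriv F z‖ ≤ C * (1 + ‖F z‖ ^ 2)) (h1 : 1 ≤ ‖F c‖) :
    ∀ z ∈ ball c r, 1 / 4 < ‖F z‖ := by
  intro z hz
  have hv : ‖z - c‖ < r := by simpa [dist_eq_norm] using hz
  have hmem : ∀ t ∈ Set.Icc (0 : ℝ) 1, c + t * (z - c) ∈ ball c r := by
    intro t ht
    rw [mem_ball, dist_eq_norm, add_sub_cancel_left, norm_mul, norm_real,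
      Real.norm_of_nonneg ht.1]
    nlinarith [norm_nonneg (z - c), ht.2]
  have hder : ∀ t ∈ Set.Icc (0 : ℝ) 1, HasDerivWithinAt
      (fun t : ℝ => (1 + ‖F (c + t * (z - c))‖ ^ 2)⁻¹)
      (-(2 * inner ℝ (F (c + t * (z - c))) (deriv F (c + t * (z - c)) * (z - c))) /
        (1 + ‖F (c + t * (z - c))‖ ^ 2) ^ 2) (Set.Icc 0 1) t := by
    intro t ht
    have h2 := aux_line (hF.differentiableAt (isOpen_ball.mem_nhds (hmem t ht)))
    have h3 := (h2.norm_sq.const_add 1).fun_inv (by positivity)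
    exact h3.hasDerivWithinAt
  have hbound : ∀ t ∈ Set.Icc (0 : ℝ) 1,
      ‖(-(2 * inner ℝ (F (c + t * (z - c))) (deriv F (c + t * (z - c)) * (z - c))) /
        (1 + ‖F (c + t * (z - c))‖ ^ 2) ^ 2)‖ ≤ 1 / 4 := by
    intro t ht
    have h4 := hb _ (hmem t ht)
    generalize F (c + t * (z - c)) = x at *
    generalize deriv F (c + t * (z - c)) = y at *
    have h5 := norm_inner_le_norm (𝕜 := ℝ) x (y * (z - c))
    rw [norm_div, norm_neg, norm_mul, norm_pow, Real.norm_of_nonneg (by positivity : 0 ≤ 1 + ‖x‖ ^ 2),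
      div_le_iff₀ (by positivity)]
    rw [norm_mul] at h5
    have h6 : C * ‖z - c‖ ≤ 1 / 4 := by
      have := hv.le.trans hrC
      rw [le_div_iff₀ (by positivity)] at this
      linarith
    have h7 : ‖y‖ * ‖z - c‖ ≤ 1 / 4 * (1 + ‖x‖ ^ 2) := by
      calc ‖y‖ * ‖z - c‖ ≤ C * (1 + ‖x‖ ^ 2) * ‖z - c‖ := by gcongr
        _ = (C * ‖z - c‖) * (1 + ‖x‖ ^ 2) := by ring
        _ ≤ _ := by gcongr
    have h8 : 2 * ‖x‖ ≤ 1 + ‖x‖ ^ 2 := by nlinarith [sq_nonneg (‖x‖ - 1)]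
    calc ‖(2 : ℝ)‖ * ‖inner ℝ x (y * (z - c))‖ ≤ 2 * (‖x‖ * (‖y‖ * ‖z - c‖)) := by
          rw [Real.norm_of_nonneg (by norm_num : (0 : ℝ) ≤ 2)]; gcongr
      _ = (2 * ‖x‖) * (‖y‖ * ‖z - c‖) := by ring
      _ ≤ (1 + ‖x‖ ^ 2) * (1 / 4 * (1 + ‖x‖ ^ 2)) := by gcongr
      _ = _ := by ring
  have h9 := (convex_Icc (0 : ℝ) 1).norm_image_sub_le_of_norm_hasDerivWithin_le hder hbound
    (Set.left_mem_Icc.2 zero_le_one) (Set.right_mem_Icc.2 zero_le_one)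
  simp only [ofReal_one, ofReal_zero, one_mul, zero_mul, add_zero, add_sub_cancel, sub_zero,
    norm_one, mul_one] at h9
  have h10 := (le_abs_self _).trans h9
  have h11 : (1 + ‖F c‖ ^ 2)⁻¹ ≤ 1 / 2 := by
    rw [inv_eq_one_div]; gcongr; nlinarith
  have h12 : (1 + ‖F z‖ ^ 2)⁻¹ ≤ 3 / 4 := by linarith
  rw [inv_le_comm₀ (by positivity) (by norm_num)] at h12
  by_contra hcon
  push Not at hcon
  nlinarith [norm_nonneg (F z)]

/-- Growth control of a spherically Lipschitz function along vertical lines. -/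
lemma aux_grow {F : ℂ → ℂ} {a C : ℝ} (hC : 0 < C)
    (hF : ∀ w : ℂ, a < w.re → DifferentiableAt ℂ F w)
    (hb : ∀ w : ℂ, a < w.re → ‖deriv F w‖ ≤ C * (1 + ‖F w‖ ^ 2)) :
    ∃ A : ℝ, 0 ≤ A ∧ ∀ w : ℂ, a + 1 < w.re → ∀ t : ℝ,
      1 + Real.log (1 + ‖F (w + t * I)‖ ^ 2) ≤
        (1 + Real.log (1 + ‖F w‖ ^ 2)) * Real.exp (A * |t|) := by
  set r : ℝ := min 1 (1 / (4 * C)) with hr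
  have hr0 : 0 < r := by positivity
  have hball : ∀ w : ℂ, a + 1 < w.re → ∀ z ∈ ball w r, a < z.re := by
    intro w hw z hz
    have h1 : ‖z - w‖ < 1 := by
      have : ‖z - w‖ < r := by simpa [dist_eq_norm] using hz
      exact this.trans_le (min_le_left _ _)
    have h2 := (abs_re_le_norm (z - w))
    rw [sub_re] at h2
    have := abs_le.1 h2
    linarith
  have key : ∀ w : ℂ, a + 1 < w.re → 2 * ‖F w‖ * ‖deriv F w‖ ≤
      (2 * C + 12 / r) * (1 + Real.log (1 + ‖F w‖ ^ 2)) * (1 + ‖F w‖ ^ 2) := by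
    intro w hw
    have hL : 0 ≤ Real.log (1 + ‖F w‖ ^ 2) := Real.log_nonneg (by nlinarith [norm_nonneg (F w)])
    rcases le_total ‖F w‖ 1 with h1 | h1
    · have h2 := hb w (by linarith)
      calc 2 * ‖F w‖ * ‖deriv F w‖ ≤ 2 * 1 * (C * (1 + ‖F w‖ ^ 2)) := by gcongr
        _ = (2 * C + 0) * (1 + 0) * (1 + ‖F w‖ ^ 2) := by ring
        _ ≤ _ := by gcongr; positivity
    · have hd : DifferentiableOn ℂ F (ball w r) := fun z hz =>
        (hF z (hball w hw z hz)).differentiableWithinAt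
      have h2 := aux_harnack hr0 hd (aux_lower hC (min_le_right _ _) hd
        (fun z hz => hb z (hball w hw z hz)) h1)
      have h3 : Real.log ‖F w‖ ≤ Real.log (1 + ‖F w‖ ^ 2) :=
        Real.log_le_log (by linarith) (by nlinarith)
      have h4 : Real.log 4 ≤ 3 := by
        have := Real.log_le_sub_one_of_pos (by norm_num : (0 : ℝ) < 4)
        linarith
      calc 2 * ‖F w‖ * ‖deriv F w‖
          ≤ 2 * ‖F w‖ * (‖F w‖ * (2 / r * (Real.log ‖F w‖ + Real.log 4))) := by gcongr
        _ ≤ 2 * ‖F w‖ * (‖F w‖ * (2 / r * (3 * (1 + Real.log (1 + ‖F w‖ ^ 2))))) := by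
            gcongr; linarith
        _ = (0 + 12 / r) * (1 + Real.log (1 + ‖F w‖ ^ 2)) * (0 + ‖F w‖ ^ 2) := by ring
        _ ≤ _ := by gcongr <;> positivity
  refine ⟨2 * C + 12 / r, by positivity, fun w hw t => ?_⟩
  have hpos : ∀ z : ℂ, 0 < 1 + Real.log (1 + ‖F z‖ ^ 2) := fun z => by
    have : 0 ≤ Real.log (1 + ‖F z‖ ^ 2) := Real.log_nonneg (by nlinarith [norm_nonneg (F z)])
    linarith
  have hre : ∀ s : ℝ, a + 1 < (w + s * I).re := fun s => by simpa using hw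
  have hder : ∀ s ∈ (Set.univ : Set ℝ), HasDerivWithinAt
      (fun s : ℝ => Real.log (1 + Real.log (1 + ‖F (w + s * I)‖ ^ 2)))
      (2 * inner ℝ (F (w + s * I)) (deriv F (w + s * I) * I) / (1 + ‖F (w + s * I)‖ ^ 2) /
        (1 + Real.log (1 + ‖F (w + s * I)‖ ^ 2))) Set.univ s := by
    intro s _
    have h2 := aux_line (hF (w + s * I) (by linarith [hre s]))
    have h3 := (h2.norm_sq.const_add 1).log (by positivity)
    have h4 := (h3.const_add 1).log (hpos _).ne'
    exact h4.hasDerivWithinAt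
  have hbound : ∀ s ∈ (Set.univ : Set ℝ),
      ‖2 * inner ℝ (F (w + s * I)) (deriv F (w + s * I) * I) / (1 + ‖F (w + s * I)‖ ^ 2) /
        (1 + Real.log (1 + ‖F (w + s * I)‖ ^ 2))‖ ≤ 2 * C + 12 / r := by
    intro s _
    have h2 := key _ (hre s)
    have h3 := hpos (w + s * I)
    have h5 := norm_inner_le_norm (𝕜 := ℝ) (F (w + s * I)) (deriv F (w + s * I) * I)
    rw [norm_mul, norm_I, mul_one] at h5
    rw [norm_div, norm_div, norm_mul, Real.norm_of_nonneg h3.le,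
      Real.norm_of_nonneg (by positivity : 0 ≤ 1 + ‖F (w + s * I)‖ ^ 2),
      Real.norm_of_nonneg (by norm_num : (0 : ℝ) ≤ 2), div_le_iff₀ h3, div_le_iff₀ (by positivity)]
    linarith
  have h9 := convex_univ.norm_image_sub_le_of_norm_hasDerivWithin_le hder hbound
    (Set.mem_univ (0 : ℝ)) (Set.mem_univ t)
  simp only [ofReal_zero, zero_mul, add_zero, sub_zero, Real.norm_eq_abs] at h9
  have h10 := (le_abs_self _).trans h9
  rw [← Real.log_le_log_iff (hpos _) (mul_pos (hpos _) (Real.exp_pos _)),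
    Real.log_mul (hpos _).ne' (Real.exp_pos _).ne', Real.log_exp]
  linarith

/-- The estimate of the first part. -/
lemma aux_bound_s19 (G : ℂ → ℂ) (hG : Differentiable ℂ G) (m : ℕ)
    (M : ℝ) (hM : 0 < M)
    (hbd : ∀ n : ℕ, 1 ≤ n → ∀ z : ℂ, 1 ≤ ‖z‖ → ‖z‖ ≤ 2 →
      sphericalDeriv (fun w : ℂ => G ((2 : ℂ) ^ n * w) / (2 : ℂ) ^ (n * m)) z ≤ M)
    (ζ : ℂ) (hζ : 2 ≤ ‖ζ‖) :
    ‖ζ‖ * sphericalDeriv (fun w : ℂ => G w / w ^ m) ζ ≤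
          M * 2 ^ (m + 1) + (m : ℝ) * 2 ^ (2 * m) := by
  obtain ⟨n, hn1, hn2⟩ := exists_nat_pow_near (by linarith : 1 ≤ ‖ζ‖) (by norm_num : (1 : ℝ) < 2)
  have hn : 1 ≤ n := by
    by_contra h
    have : n = 0 := by omega
    subst this
    norm_num at hn2
    linarith
  have hζ0 : ζ ≠ 0 := norm_pos_iff.1 (by linarith)
  have hs1 : 1 ≤ ‖ζ / 2 ^ n‖ := by
    rw [norm_div, norm_pow, Complex.norm_ofNat, le_div_iff₀ (by positivity)]; linarith
  have hs2 : ‖ζ / 2 ^ n‖ ≤ 2 := by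
    rw [norm_div, norm_pow, Complex.norm_ofNat, div_le_iff₀ (by positivity)]
    rw [pow_succ] at hn2; linarith
  have h := hbd n hn (ζ / 2 ^ n) hs1 hs2
  have hz : (2 : ℂ) ^ n * (ζ / 2 ^ n) = ζ := by field_simp
  have hd1 : HasDerivAt (fun w : ℂ => G ((2 : ℂ) ^ n * w) / (2 : ℂ) ^ (n * m))
      (deriv G ζ * 2 ^ n / 2 ^ (n * m)) (ζ / 2 ^ n) := by
    have h1 : HasDerivAt (fun w : ℂ => (2 : ℂ) ^ n * w) (2 ^ n) (ζ / 2 ^ n) := by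
      simpa using (hasDerivAt_id (ζ / 2 ^ n)).const_mul ((2 : ℂ) ^ n)
    have h2 : HasDerivAt G (deriv G ζ) ((2 : ℂ) ^ n * (ζ / 2 ^ n)) := by
      rw [hz]; exact (hG ζ).hasDerivAt
    exact (HasDerivAt.comp (ζ / 2 ^ n) h2 h1).div_const _
  have hd2 : HasDerivAt (fun w : ℂ => G w / w ^ m)
      (deriv G ζ / ζ ^ m - m * (G ζ / ζ ^ m) / ζ) ζ := by
    refine ((hG ζ).hasDerivAt.fun_div (hasDerivAt_pow m ζ) (pow_ne_zero m hζ0)).congr_deriv ?_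
    rcases m with _ | k
    · simp
    · simp only [Nat.add_sub_cancel]
      field_simp
      ring
  unfold sphericalDeriv at h ⊢
  rw [hd1.deriv] at h
  simp only [hz] at h
  rw [hd2.deriv]
  set s : ℝ := ‖ζ / 2 ^ n‖ with hs
  have hζs : ‖ζ‖ = 2 ^ n * s := by
    rw [hs, norm_div, norm_pow, Complex.norm_ofNat]; field_simp
  set x : ℝ := ‖G ζ / ζ ^ m‖ with hx
  have hx0 : 0 ≤ x := norm_nonneg _
  set g : ℝ := ‖G ζ / 2 ^ (n * m)‖ with hg
  have hg0 : 0 ≤ g := norm_nonneg _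
  have hgx : g = x * s ^ m := by
    rw [hg, hx, norm_div, norm_div, norm_pow, norm_pow, hζs, Complex.norm_ofNat, mul_pow, ← pow_mul]
    field_simp
  have hsm : 1 ≤ s ^ m := one_le_pow₀ hs1
  rw [div_le_iff₀ (by positivity), norm_div, norm_mul, norm_pow, norm_pow,
    Complex.norm_ofNat] at h
  have hA : ‖ζ‖ * ‖deriv G ζ / ζ ^ m‖ ≤ M * 2 ^ (m + 1) * (1 + x ^ 2) := by
    have e1 : ‖ζ‖ * ‖deriv G ζ / ζ ^ m‖ = s / s ^ m * (‖deriv G ζ‖ * 2 ^ n / 2 ^ (n * m)) := by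
      rw [norm_div, norm_pow, hζs, mul_pow, ← pow_mul]
      field_simp
    rw [e1]
    calc s / s ^ m * (‖deriv G ζ‖ * 2 ^ n / 2 ^ (n * m))
        ≤ s / s ^ m * (M * (1 + g ^ 2)) := by gcongr
      _ ≤ s / s ^ m * (M * ((s ^ m) ^ 2 * (1 + x ^ 2))) := by
          gcongr
          rw [hgx, mul_pow]
          nlinarith
      _ = M * s ^ (m + 1) * (1 + x ^ 2) := by
          field_simp; ring
      _ ≤ M * 2 ^ (m + 1) * (1 + x ^ 2) := by gcongr
  have hB : ‖ζ‖ * ‖(m : ℂ) * (G ζ / ζ ^ m) / ζ‖ ≤ m * 2 ^ (2 * m) * (1 + x ^ 2) := by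
    have e2 : ‖ζ‖ * ‖(m : ℂ) * (G ζ / ζ ^ m) / ζ‖ = m * 1 * x := by
      rw [norm_div, norm_mul, ← hx, Complex.norm_natCast]
      field_simp [norm_ne_zero_iff.2 hζ0]
    rw [e2]
    gcongr
    · exact one_le_pow₀ (by norm_num)
    · nlinarith [sq_nonneg (x - 1)]
  rw [← mul_div_assoc, div_le_iff₀ (by positivity), add_mul]
  calc _ ≤ ‖ζ‖ * (‖deriv G ζ / ζ ^ m‖ + ‖(m : ℂ) * (G ζ / ζ ^ m) / ζ‖) := by
        gcongr; exact norm_sub_le _ _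
    _ ≤ _ := by rw [mul_add]; exact add_le_add hA hB

theorem stmt_19 (G : ℂ → ℂ) (hG : Differentiable ℂ G) (m : ℕ) (hm : 1 ≤ m)
    (M : ℝ) (hM : 0 < M)
    (hbd : ∀ n : ℕ, 1 ≤ n → ∀ z : ℂ, 1 ≤ ‖z‖ → ‖z‖ ≤ 2 →
      sphericalDeriv (fun w : ℂ => G ((2 : ℂ) ^ n * w) / (2 : ℂ) ^ (n * m)) z ≤ M) :
    (∀ ζ : ℂ, 2 ≤ ‖ζ‖ →
        ‖ζ‖ * sphericalDeriv (fun w : ℂ => G w / w ^ m) ζ ≤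
          M * 2 ^ (m + 1) + (m : ℝ) * 2 ^ (2 * m)) ∧
      ∃ p : Polynomial ℂ, ∀ z : ℂ, G z = p.eval z := by
  have hmain := aux_bound_s19 G hG m M hM hbd
  refine ⟨hmain, ?_⟩
  set C : ℝ := M * 2 ^ (m + 1) + (m : ℝ) * 2 ^ (2 * m) with hCdef
  have hC : 0 < C := by positivity
  set r : ℂ → ℂ := fun w : ℂ => G w / w ^ m with hr
  have hexp2 : ∀ w : ℂ, Real.log 2 < w.re → 2 ≤ ‖exp w‖ := by
    intro w hw
    rw [norm_exp, ← Real.exp_log (by norm_num : (0 : ℝ) < 2)]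
    exact Real.exp_le_exp.2 hw.le
  have hrd : ∀ z : ℂ, z ≠ 0 → DifferentiableAt ℂ r z := fun z hz =>
    (hG z).fun_div (differentiableAt_pow m) (pow_ne_zero m hz)
  have hFd : ∀ w : ℂ, HasDerivAt (fun w => r (exp w)) (deriv r (exp w) * exp w) w := fun w =>
    HasDerivAt.comp w (hrd _ (exp_ne_zero w)).hasDerivAt (hasDerivAt_exp w)
  obtain ⟨A, hA, hgrow⟩ := aux_grow (F := fun w => r (exp w)) (a := Real.log 2) hC
    (fun w _ => (hFd w).differentiableAt) (fun w hw => by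
      rw [(hFd w).deriv]
      have h1 := hmain _ (hexp2 w hw)
      unfold sphericalDeriv at h1
      rw [← mul_div_assoc, div_le_iff₀ (by positivity)] at h1
      rw [norm_mul, mul_comm]
      exact h1)
  by_cases hcase : ∃ B : ℝ, ∀ R₀ : ℝ, ∃ z : ℂ, R₀ ≤ ‖z‖ ∧ ‖r z‖ ≤ B
  · obtain ⟨B, hB⟩ := hcase
    set L : ℝ := (1 + Real.log (1 + B ^ 2)) * Real.exp (A * (2 * Real.pi)) with hL
    refine aux_poly hG (Real.exp L) m fun R₀ => ?_
    obtain ⟨z₀, hz₀, hz₀B⟩ := hB (max R₀ 10)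
    refine ⟨‖z₀‖, (le_max_left _ _).trans hz₀, fun z hz => ?_⟩
    have h10 : 10 ≤ ‖z₀‖ := (le_max_right _ _).trans hz₀
    have hz0 : z₀ ≠ 0 := norm_pos_iff.1 (by linarith)
    have hz1 : z ≠ 0 := norm_pos_iff.1 (by linarith)
    have hre : Real.log 2 + 1 < (log z₀).re := by
      rw [log_re]
      have h3 : 1 < Real.log 4 := by
        rw [Real.lt_log_iff_exp_lt (by norm_num)]
        linarith [Real.exp_one_lt_d9]
      have h4 : Real.log 2 + Real.log 4 = Real.log 8 := by
        rw [← Real.log_mul (by norm_num) (by norm_num)]; norm_num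
      have h5 : Real.log 8 ≤ Real.log ‖z₀‖ := Real.log_le_log (by norm_num) (by linarith)
      linarith
    have h1 := hgrow (log z₀) hre (arg z - arg z₀)
    have h2 : log z₀ + ((arg z - arg z₀ : ℝ) : ℂ) * I = log z := by
      rw [log, log, hz]; push_cast; ring
    rw [h2] at h1
    simp only [exp_log hz0, exp_log hz1] at h1
    have h3 : |arg z - arg z₀| ≤ 2 * Real.pi := by
      have := abs_le.1 (abs_arg_le_pi z)
      have := abs_le.1 (abs_arg_le_pi z₀)
      rw [abs_le]; constructor <;> linarith
    have hl0 : 0 ≤ Real.log (1 + ‖r z₀‖ ^ 2) := Real.log_nonneg (by nlinarith [norm_nonneg (r z₀)])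
    have h4 : 1 + Real.log (1 + ‖r z‖ ^ 2) ≤ L := by
      refine h1.trans ?_
      have hl1 : 0 ≤ Real.log (1 + B ^ 2) := Real.log_nonneg (by nlinarith [sq_nonneg B])
      rw [hL]
      gcongr
    have h5 : 1 + ‖r z‖ ^ 2 ≤ Real.exp L := by
      rw [← Real.log_le_iff_le_exp (by positivity)]
      linarith
    have h6 : ‖r z‖ ≤ Real.exp L := by nlinarith [sq_nonneg (‖r z‖ - 1)]
    have h7 : ‖G z‖ = ‖r z‖ * ‖z‖ ^ m := by
      rw [hr]; simp only [norm_div, norm_pow]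
      have := norm_ne_zero_iff.2 hz1
      field_simp
    rw [h7, hz]
    gcongr
  · push Not at hcase
    refine aux_proper hG fun B => ?_
    obtain ⟨R, hR⟩ := hcase B
    refine ⟨max R 1, fun z hz => ?_⟩
    have h1 := hR z ((le_max_left _ _).trans hz)
    have h2 : 1 ≤ ‖z‖ := (le_max_right _ _).trans hz
    have h7 : ‖G z‖ = ‖r z‖ * ‖z‖ ^ m := by
      rw [hr]; simp only [norm_div, norm_pow]
      have : ‖z‖ ≠ 0 := by linarith
      field_simp
    rw [h7]
    have h8 : 1 ≤ ‖z‖ ^ m := one_le_pow₀ h2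
    nlinarith [norm_nonneg (r z)]
end
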